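/- There exist constants d > 0, ε > 0 and n₀ ∈ ℕ such that for every n ≥ n₀ and every SL_n(ℝ)-invariant Borel probability measure ν on SL_n(ℝ)/SL_n(ℤ), ν({g·SL_n(ℤ) : μ(g·ℤⁿ) ≥ d√n}) ≤ 2^{−εn}, where μ(Λ) = sup_{x ∈ ℝⁿ} dist(x, Λ) is the covering radius of the lattice Λ. -/

import Mathlib

open MeasureTheory Matrix Metric

noncomputable section

/-- `SL n` is the special linear group `SL_n(ℝ)`. -/
abbrev SL (n : ℕ) : Type := Matrix.SpecialLinearGroup (Fin n) ℝ

/-- The subgroup `SL_n(ℤ)` of `SL_n(ℝ)` (image of the integral special linear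
group under the coefficient embedding `ℤ → ℝ`). -/
def SLZ (n : ℕ) : Subgroup (SL n) :=
  (Matrix.SpecialLinearGroup.map (n := Fin n) (Int.castRingHom ℝ)).range

instance (n : ℕ) : TopologicalSpace (SL n) :=
  TopologicalSpace.induced (fun g : SL n => (g : Matrix (Fin n) (Fin n) ℝ)) inferInstance

/-- The space of lattices `SL_n(ℝ)/SL_n(ℤ)` carries the Borel σ-algebra of its
quotient topology. -/
instance (n : ℕ) : MeasurableSpace (SL n ⧸ SLZ n) := borel _

/-- The lattice `g·ℤⁿ ⊆ ℝⁿ` attached to `g ∈ SL_n(ℝ)`. -/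
def latticeOf {n : ℕ} (g : SL n) : Set (EuclideanSpace ℝ (Fin n)) :=
  {x | ∃ v : Fin n → ℤ,
    x = (EuclideanSpace.equiv (Fin n) ℝ).symm
          ((g : Matrix (Fin n) (Fin n) ℝ).mulVec fun j => (v j : ℝ))}

/-- The covering radius `μ(Λ) = sup_{x ∈ ℝⁿ} dist(x, Λ)` of a (full-rank)
lattice `Λ ⊆ ℝⁿ`. -/
def covRadOf {n : ℕ} (Λ : Set (EuclideanSpace ℝ (Fin n))) : ℝ :=
  ⨆ x : EuclideanSpace ℝ (Fin n), infDist x Λ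

open Finset in
/-- Sum over a product of copies of `ℤ` of a product of summable functions. -/
theorem summable_pi_prod {ι : Type*} [Fintype ι] {g : ℤ → ℝ} (hg0 : ∀ k, 0 ≤ g k)
    (hg : Summable g) : Summable fun z : ι → ℤ => ∏ i, g (z i) := by
  classical
  refine summable_of_sum_le (c := (∑' k, g k) ^ Fintype.card ι)
    (fun z => prod_nonneg fun i _ => hg0 _) fun s => ?_
  calc ∑ z ∈ s, ∏ i, g (z i)
      ≤ ∑ z ∈ Fintype.piFinset fun i => s.image (fun z => z i), ∏ i, g (z i) := by
        refine sum_le_sum_of_subset_of_nonneg (fun z hz => ?_) fun z _ _ =>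
          prod_nonneg fun i _ => hg0 _
        exact Fintype.mem_piFinset.2 fun i => mem_image_of_mem _ hz
    _ = ∏ i, ∑ k ∈ s.image (fun z => z i), g k := (prod_univ_sum _ _).symm
    _ ≤ ∏ _i : ι, ∑' k, g k := prod_le_prod (fun i _ => sum_nonneg fun k _ => hg0 k)
        fun i _ => hg.sum_le_tsum _ fun k _ => hg0 k
    _ = _ := by simp

theorem summable_exp_neg_mul_sq_int {a : ℝ} (ha : 0 < a) :
    Summable fun k : ℤ => Real.exp (-a * (k : ℝ) ^ 2) := by
  have h : Summable fun k : ℕ => Real.exp (-a * (k : ℝ) ^ 2) := by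
    refine Summable.of_nonneg_of_le (fun _ => (Real.exp_pos _).le) (fun k => ?_)
      (Real.summable_exp_nat_mul_iff.2 (neg_lt_zero.2 ha))
    rw [Real.exp_le_exp]
    have : (k : ℝ) ≤ (k : ℝ) ^ 2 := by exact_mod_cast Nat.le_self_pow two_ne_zero k
    nlinarith
  exact Summable.of_nat_of_neg (by simpa using h) (by simpa using h)

variable {ι : Type*} [Fintype ι]

/-- The squared Euclidean length of a coordinate vector. -/
def sqNorm (v : ι → ℝ) : ℝ := ∑ i, v i ^ 2

theorem sqNorm_nonneg (v : ι → ℝ) : 0 ≤ sqNorm v := Finset.sum_nonneg fun _ _ => sq_nonneg _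

theorem continuous_sqNorm : Continuous (sqNorm : (ι → ℝ) → ℝ) := by
  unfold sqNorm; fun_prop

theorem sqNorm_mulVec_le (B : Matrix ι ι ℝ) (x : ι → ℝ) :
    sqNorm (B *ᵥ x) ≤ (∑ i, ∑ j, B i j ^ 2) * sqNorm x := by
  rw [Finset.sum_mul]
  exact Finset.sum_le_sum fun i _ => Finset.sum_mul_sq_le_sq_mul_sq _ _ _

theorem exists_mul_sqNorm_le [DecidableEq ι] {A : Matrix ι ι ℝ} (hA : A.det ≠ 0) :
    ∃ κ > 0, ∀ y, κ * sqNorm y ≤ sqNorm (A *ᵥ y) := by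
  set C : ℝ := ∑ i, ∑ j, A⁻¹ i j ^ 2
  have hC : 0 ≤ C := by positivity
  refine ⟨(C + 1)⁻¹, by positivity, fun y => ?_⟩
  rw [inv_mul_le_iff₀ (by positivity)]
  calc sqNorm y = sqNorm (A⁻¹ *ᵥ (A *ᵥ y)) := by
        rw [Matrix.mulVec_mulVec, Matrix.nonsing_inv_mul _ (isUnit_iff_ne_zero.2 hA),
          Matrix.one_mulVec]
    _ ≤ C * sqNorm (A *ᵥ y) := sqNorm_mulVec_le _ _
    _ ≤ (C + 1) * sqNorm (A *ᵥ y) := by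
        have := sqNorm_nonneg (A *ᵥ y); nlinarith

/-- The coordinatewise real cast of an integer vector. -/
def intVec (z : ι → ℤ) : ι → ℝ := fun i => z i

theorem exists_summable_bound [DecidableEq ι] {A : Matrix ι ι ℝ} (hA : A.det ≠ 0) {t : ℝ}
    (ht : 0 < t) (M : ℝ) : ∃ b : (ι → ℤ) → ℝ, Summable b ∧ ∀ x : ι → ℝ, (∀ i, |x i| ≤ M) →
      ∀ z, Real.exp (-(Real.pi * t * sqNorm (A *ᵥ (x + intVec z)))) ≤ b z := by
  obtain ⟨κ, hκ, hA⟩ := exists_mul_sqNorm_le hA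
  set a := Real.pi * t * κ
  have ha : 0 < a := by positivity
  let g : ℤ → ℝ := fun k => Real.exp (a * M ^ 2) * Real.exp (-(a / 2) * (k : ℝ) ^ 2)
  have hg : Summable g := (summable_exp_neg_mul_sq_int (half_pos ha)).mul_left _
  have hg0 : ∀ k, 0 ≤ g k := fun _ => by positivity
  refine ⟨fun z => ∏ i, g (z i), summable_pi_prod hg0 hg, fun x hx z => ?_⟩
  have h1 : -(Real.pi * t * sqNorm (A *ᵥ (x + intVec z))) ≤ -(a * sqNorm (x + intVec z)) := by
    have := mul_le_mul_of_nonneg_left (hA (x + intVec z)) (by positivity : 0 ≤ Real.pi * t)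
    simp only [a]; linarith
  refine (Real.exp_le_exp.2 h1).trans ?_
  rw [sqNorm, Finset.mul_sum, ← Finset.sum_neg_distrib, Real.exp_sum]
  refine Finset.prod_le_prod (fun _ _ => (Real.exp_pos _).le) fun i _ => ?_
  simp only [g]
  rw [← Real.exp_add, Real.exp_le_exp]
  have h2 : (x i) ^ 2 ≤ M ^ 2 := sq_le_sq' (by linarith [neg_le_of_abs_le (hx i)])
    (le_of_abs_le (hx i))
  simp only [Pi.add_apply, intVec]
  have h3 : (z i : ℝ) ^ 2 / 2 - M ^ 2 ≤ (x i + z i) ^ 2 := by nlinarith [sq_nonneg (2 * x i + z i)]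
  nlinarith

theorem integral_comp_mulVec [DecidableEq ι] {A : Matrix ι ι ℝ} (hA : A.det ≠ 0)
    (f : (ι → ℝ) → ℂ) : ∫ x, f (A *ᵥ x) = |A.det|⁻¹ * ∫ x, f x := by
  have hi := Real.map_matrix_volume_pi_eq_smul_volume_pi hA
  have he : MeasurableEmbedding (Matrix.toLin' A) :=
    ((LinearEquiv.ofIsUnitDet (f := Matrix.toLin' A) (v := Pi.basisFun ℝ ι)
      (v' := Pi.basisFun ℝ ι) (by simpa [LinearMap.toMatrix_eq_toMatrix'] using hA))
      |>.toContinuousLinearEquiv.toHomeomorph.measurableEmbedding)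
  have := he.integral_map (μ := volume) f
  rw [hi, integral_smul_measure, ENNReal.toReal_ofReal (abs_nonneg _)] at this
  simp only [Matrix.toLin'_apply] at this
  rw [← this, abs_inv, Complex.real_smul]

open Complex in
/-- The Fourier transform of the Gaussian `exp (-π t |A x|²)`. -/
theorem integral_gaussian_mulVec [DecidableEq ι] {A : Matrix ι ι ℝ} (hA : A.det ≠ 0) {t : ℝ}
    (ht : 0 < t) (w : ι → ℝ) :
    ∫ x : ι → ℝ, cexp (-(2 * Real.pi * I * (w ⬝ᵥ x : ℝ))) *
        Real.exp (-(Real.pi * t * sqNorm (A *ᵥ x))) =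
      ((|A.det|⁻¹ * (1 / t) ^ (Fintype.card ι / 2 : ℝ) *
        Real.exp (-(Real.pi / t * sqNorm (A⁻¹ᵀ *ᵥ w))) : ℝ) : ℂ) := by
  set w' := A⁻¹ᵀ *ᵥ w
  have hdot : ∀ x, w ⬝ᵥ x = w' ⬝ᵥ (A *ᵥ x) := fun x => by
    rw [Matrix.dotProduct_mulVec, ← Matrix.mulVec_transpose, Matrix.mulVec_mulVec,
      ← Matrix.transpose_mul, Matrix.nonsing_inv_mul _ (isUnit_iff_ne_zero.2 hA),
      Matrix.transpose_one, Matrix.one_mulVec]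
  simp_rw [hdot]
  rw [integral_comp_mulVec hA (fun y => cexp (-(2 * Real.pi * I * (w' ⬝ᵥ y : ℝ))) *
        Real.exp (-(Real.pi * t * sqNorm y)))]
  have key := GaussianFourier.integral_cexp_neg_mul_sum_add (ι := ι) (b := ((Real.pi * t : ℝ) : ℂ))
    (by rw [ofReal_re]; positivity) (fun i => -(2 * Real.pi * I * w' i))
  have e1 : ∀ y : ι → ℝ, cexp (-(2 * Real.pi * I * (w' ⬝ᵥ y : ℝ))) *
        Real.exp (-(Real.pi * t * sqNorm y)) = cexp (-((Real.pi * t : ℝ) : ℂ) * ∑ i, (y i : ℂ) ^ 2 +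
          ∑ i, -(2 * Real.pi * I * w' i) * y i) := fun y => by
    rw [ofReal_exp, ← Complex.exp_add]
    congr 1
    simp only [dotProduct, sqNorm, ofReal_neg, ofReal_mul, ofReal_sum, ofReal_pow, Finset.mul_sum]
    rw [← Finset.sum_neg_distrib, ← Finset.sum_neg_distrib, add_comm, ← Finset.sum_add_distrib,
      ← Finset.sum_add_distrib]
    refine Finset.sum_congr rfl fun i _ => by ring
  simp_rw [e1, key]
  have e2 : (Real.pi : ℂ) / ((Real.pi * t : ℝ) : ℂ) = ((1 / t : ℝ) : ℂ) := by
    push_cast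
    have : (Real.pi : ℂ) ≠ 0 := by exact_mod_cast Real.pi_ne_zero
    have : (t : ℂ) ≠ 0 := by exact_mod_cast ht.ne'
    field_simp
  have e3 : (Fintype.card ι / 2 : ℂ) = ((Fintype.card ι / 2 : ℝ) : ℂ) := by push_cast; rfl
  have e4 : (∑ i, (-(2 * Real.pi * I * w' i)) ^ 2) / (4 * ((Real.pi * t : ℝ) : ℂ)) =
      ((-(Real.pi / t * sqNorm w') : ℝ) : ℂ) := by
    have h1 : (Real.pi : ℂ) ≠ 0 := by exact_mod_cast Real.pi_ne_zero
    have h2 : (t : ℂ) ≠ 0 := by exact_mod_cast ht.ne'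
    have h3 : ∀ i, (-(2 * Real.pi * I * w' i)) ^ 2 = -(4 * Real.pi ^ 2) * (w' i : ℂ) ^ 2 := by
      intro i
      linear_combination 4 * Real.pi ^ 2 * (w' i : ℂ) ^ 2 * I_sq
    simp_rw [h3, ← Finset.mul_sum]
    push_cast [sqNorm]
    field_simp
  rw [e2, e3, e4, ← ofReal_cpow (by positivity), ← ofReal_exp]
  push_cast
  ring

/-- The Gaussian mass of the translate by `A *ᵥ x` of the lattice spanned by the columns of `A`. -/
def gaussMass (A : Matrix ι ι ℝ) (t : ℝ) (x : ι → ℝ) : ℝ :=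
  ∑' z : ι → ℤ, Real.exp (-(Real.pi * t * sqNorm (A *ᵥ (x + intVec z))))

theorem intVec_zero {ι : Type*} : intVec (0 : ι → ℤ) = 0 := by
  ext i; simp [intVec]

theorem intVec_add {ι : Type*} (z w : ι → ℤ) : intVec (z + w) = intVec z + intVec w := by
  ext i; simp [intVec]

theorem gaussMass_add_intVec (A : Matrix ι ι ℝ) (t : ℝ) (x : ι → ℝ) (k : ι → ℤ) :
    gaussMass A t (x + intVec k) = gaussMass A t x := by
  unfold gaussMass
  rw [← (Equiv.addLeft k).tsum_eq fun z =>
    Real.exp (-(Real.pi * t * sqNorm (A *ᵥ (x + intVec z))))]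
  simp [intVec_add, add_assoc]

theorem continuous_gaussTerm (A : Matrix ι ι ℝ) (t : ℝ) (z : ι → ℤ) :
    Continuous fun x : ι → ℝ => Real.exp (-(Real.pi * t * sqNorm (A *ᵥ (x + intVec z)))) := by
  have : Continuous fun x : ι → ℝ => sqNorm (A *ᵥ (x + intVec z)) :=
    continuous_sqNorm.comp (by fun_prop)
  fun_prop

theorem abs_le_one_add_norm {x y : ι → ℝ} (h : dist y x ≤ 1) (i : ι) : |y i| ≤ ‖x‖ + 1 := by
  have h1 : ‖y‖ ≤ ‖x‖ + 1 := by
    have := norm_le_norm_add_norm_sub' y x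
    rw [← dist_eq_norm] at this; linarith
  exact (norm_le_pi_norm y i).trans h1

theorem summable_gaussTerm [DecidableEq ι] {A : Matrix ι ι ℝ} (hA : A.det ≠ 0) {t : ℝ} (ht : 0 < t)
    (x : ι → ℝ) :
    Summable fun z : ι → ℤ => Real.exp (-(Real.pi * t * sqNorm (A *ᵥ (x + intVec z)))) := by
  obtain ⟨b, hb, h⟩ := exists_summable_bound hA ht (‖x‖ + 1)
  exact Summable.of_nonneg_of_le (fun _ => (Real.exp_pos _).le)
    (h x fun i => abs_le_one_add_norm (by simp) i) hb

theorem continuous_gaussMass [DecidableEq ι] {A : Matrix ι ι ℝ} (hA : A.det ≠ 0) {t : ℝ}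
    (ht : 0 < t) :
    Continuous (gaussMass A t) := by
  refine continuous_iff_continuousAt.2 fun x => ?_
  obtain ⟨b, hb, h⟩ := exists_summable_bound hA ht (‖x‖ + 1)
  have hc : ContinuousOn (gaussMass A t) (Metric.closedBall x 1) := by
    refine continuousOn_tsum (fun z => (continuous_gaussTerm A t z).continuousOn) hb
      fun z y hy => ?_
    rw [Real.norm_of_nonneg (Real.exp_pos _).le]
    exact h y (abs_le_one_add_norm hy) z
  exact hc.continuousAt (Metric.closedBall_mem_nhds x one_pos)

/-- The unit cube with corner `z`. -/
def cube (z : ι → ℤ) : Set (ι → ℝ) := {x | ∀ i, x i ∈ Set.Ioc (z i : ℝ) (z i + 1)}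

theorem cube_eq_pi {ι : Type*} (z : ι → ℤ) :
    cube z = Set.univ.pi fun i => Set.Ioc (z i : ℝ) (z i + 1) := by
  ext; simp [cube]

theorem pairwise_disjoint_cube {ι : Type*} :
    Pairwise (Function.onFun Disjoint (cube : (ι → ℤ) → _)) := by
  intro z w hzw
  refine Set.disjoint_left.2 fun x hx hy => hzw (funext fun i => ?_)
  have h1 := hx i
  have h2 := hy i
  simp only [Set.mem_Ioc] at h1 h2
  have h3 : (z i : ℝ) < w i + 1 := by linarith
  have h4 : (w i : ℝ) < z i + 1 := by linarith
  norm_cast at h3 h4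
  omega

theorem iUnion_cube {ι : Type*} : ⋃ z : ι → ℤ, cube z = Set.univ := by
  refine Set.eq_univ_of_forall fun x => Set.mem_iUnion.2 ⟨fun i => ⌈x i⌉ - 1, fun i => ?_⟩
  have h1 := Int.ceil_lt_add_one (x i)
  have h2 := Int.le_ceil (x i)
  constructor <;> push_cast <;> linarith

theorem hasSum_setIntegral_cube {E : Type*} [NormedAddCommGroup E] [NormedSpace ℝ E]
    {g : (ι → ℝ) → E} (hg : Integrable g) :
    HasSum (fun z : ι → ℤ => ∫ x in cube 0, g (x + intVec z)) (∫ x, g x) := by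
  have h := hasSum_integral_iUnion (μ := volume) (f := g) (s := (cube : (ι → ℤ) → _))
    (fun z => by rw [cube_eq_pi]; exact MeasurableSet.univ_pi fun i => measurableSet_Ioc)
    pairwise_disjoint_cube (by rw [iUnion_cube]; exact hg.integrableOn)
  rw [iUnion_cube, setIntegral_univ] at h
  refine h.congr_fun fun z => ?_
  rw [← (measurePreserving_add_right volume (intVec z)).setIntegral_preimage_emb
    (measurableEmbedding_addRight (intVec z)) g (cube z)]
  congr 2
  ext x
  simp only [cube, intVec, Set.mem_ofPred_eq, Set.mem_preimage, Pi.add_apply, Set.mem_Ioc,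
    Pi.zero_apply, Int.cast_zero]
  refine forall_congr' fun i => ?_
  constructor <;> rintro ⟨h1, h2⟩ <;> constructor <;> linarith

open Complex

/-- The additive character of `ℝⁿ` of frequency `-w`. -/
def wave (w x : ι → ℝ) : ℂ := cexp (-(2 * Real.pi * I * (w ⬝ᵥ x : ℝ)))

theorem norm_wave (w x : ι → ℝ) : ‖wave w x‖ = 1 := by
  rw [wave, show -(2 * Real.pi * I * (w ⬝ᵥ x : ℝ)) = ((-(2 * Real.pi * (w ⬝ᵥ x)) : ℝ) : ℂ) * I by
    push_cast; ring, norm_exp_ofReal_mul_I]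

theorem continuous_wave (w : ι → ℝ) : Continuous (wave w) := by
  unfold wave; fun_prop

theorem mFourier_coe (w : ι → ℤ) (x : ι → ℝ) :
    UnitAddTorus.mFourier (-w) (fun i => (x i : UnitAddCircle)) = wave (intVec w) x := by
  simp only [UnitAddTorus.mFourier, ContinuousMap.coe_mk, fourier_coe_apply, wave,
    ← Complex.exp_sum, dotProduct, intVec]
  congr 1
  push_cast
  rw [Finset.mul_sum, ← Finset.sum_neg_distrib]
  refine Finset.sum_congr rfl fun i _ => by simp [mul_assoc]

theorem wave_add_intVec (w : ι → ℤ) (x : ι → ℝ) (z : ι → ℤ) :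
    wave (intVec w) (x + intVec z) = wave (intVec w) x := by
  rw [← mFourier_coe, ← mFourier_coe]
  congr 1
  ext i
  simp [intVec]

theorem integrable_gaussian [DecidableEq ι] {A : Matrix ι ι ℝ} (hA : A.det ≠ 0) {t : ℝ}
    (ht : 0 < t) :
    Integrable fun x : ι → ℝ => Real.exp (-(Real.pi * t * sqNorm (A *ᵥ x))) := by
  obtain ⟨κ, hκ, hA⟩ := exists_mul_sqNorm_le hA
  have h := GaussianFourier.integrable_cexp_neg_mul_sum_add (ι := ι)
    (b := ((Real.pi * t * κ : ℝ) : ℂ)) (by rw [ofReal_re]; positivity) 0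
  refine h.norm.mono'
    (by simpa [intVec_zero] using (continuous_gaussTerm A t 0).aestronglyMeasurable)
    (.of_forall fun x => ?_)
  rw [Real.norm_of_nonneg (Real.exp_pos _).le, Complex.norm_exp, Real.exp_le_exp]
  have h1 : (-((Real.pi * t * κ : ℝ) : ℂ) * ∑ i, (x i : ℂ) ^ 2 +
      ∑ i, (0 : ι → ℂ) i * x i) = ((-(Real.pi * t * κ * sqNorm x) : ℝ) : ℂ) := by
    push_cast [sqNorm]; simp
  rw [h1, ofReal_re, neg_le_neg_iff]
  have := mul_le_mul_of_nonneg_left (hA x) (by positivity : 0 ≤ Real.pi * t)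
  linarith

/-- **Poisson summation** for Gaussians over a lattice in `ℝⁿ`. -/
theorem hasSum_gaussMass [DecidableEq ι] {A : Matrix ι ι ℝ} (hA : A.det ≠ 0) {t : ℝ}
    (ht : 0 < t) (x : ι → ℝ) :
    HasSum (fun w : ι → ℤ => |A.det|⁻¹ * (1 / t) ^ (Fintype.card ι / 2 : ℝ) *
        Real.exp (-(Real.pi / t * sqNorm (A⁻¹ᵀ *ᵥ intVec w))) *
          Real.cos (2 * Real.pi * (intVec w ⬝ᵥ x))) (gaussMass A t x) := by
  have hq : IsOpenQuotientMap (Pi.map fun _ : ι => ((↑) : ℝ → UnitAddCircle)) :=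
    IsOpenQuotientMap.piMap fun _ => QuotientAddGroup.isOpenQuotientMap_mk
  let p : C(ι → ℝ, UnitAddTorus ι) := ⟨_, hq.continuous⟩
  let G : C(ι → ℝ, ℂ) := ⟨fun y => (gaussMass A t y : ℂ),
    continuous_ofReal.comp (continuous_gaussMass hA ht)⟩
  have hG : Function.FactorsThrough G p := by
    intro a b hab
    have : ∀ i, ∃ k : ℤ, b i = a i + k := fun i => by
      have h : ((a i : ℝ) : UnitAddCircle) = b i := congrFun hab i
      obtain ⟨k, hk⟩ := AddSubgroup.mem_zmultiples_iff.1 (QuotientAddGroup.eq.1 h)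
      exact ⟨k, by rw [zsmul_one] at hk; linarith⟩
    choose k hk using this
    have : b = a + intVec k := funext hk
    simp only [G, ContinuousMap.coe_mk, this, gaussMass_add_intVec]
  have hp : Topology.IsQuotientMap p := hq.isQuotientMap
  let F : C(UnitAddTorus ι, ℂ) := hp.lift G hG
  have hF : ∀ y : ι → ℝ, F (fun i => (y i : UnitAddCircle)) = gaussMass A t y := fun y =>
    congrArg (fun g : C(ι → ℝ, ℂ) => g y) (hp.lift_comp G hG)
  let f : (ι → ℝ) → ℝ := fun y => Real.exp (-(Real.pi * t * sqNorm (A *ᵥ y)))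
  have hf : Integrable f := integrable_gaussian hA ht
  have hcoeff : ∀ w : ι → ℤ, UnitAddTorus.mFourierCoeff F w =
      ((|A.det|⁻¹ * (1 / t) ^ (Fintype.card ι / 2 : ℝ) *
        Real.exp (-(Real.pi / t * sqNorm (A⁻¹ᵀ *ᵥ intVec w))) : ℝ) : ℂ) := by
    intro w
    have hwf : Integrable fun y => wave (intVec w) y * (f y : ℂ) :=
      hf.ofReal.bdd_mul (c := 1) (continuous_wave _).aestronglyMeasurable
        (.of_forall fun y => (norm_wave _ y).le)
    have hmeas : MeasurableSet (cube (0 : ι → ℤ)) := by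
      rw [cube_eq_pi]; exact MeasurableSet.univ_pi fun i => measurableSet_Ioc
    rw [← integral_gaussian_mulVec hA ht (intVec w)]
    rw [UnitAddTorus.mFourierCoeff_eq_integral F w 0]
    have hcube : {y : ι → ℝ | ∀ i, y i ∈ Set.Ioc ((0 : ι → ℝ) i) ((0 : ι → ℝ) i + 1)} =
        cube 0 := by simp [cube]
    rw [hcube]
    refine Eq.trans ?_ (hasSum_setIntegral_cube hwf).tsum_eq
    have hterm : ∀ z : ι → ℤ, ∀ y, wave (intVec w) (y + intVec z) * (f (y + intVec z) : ℂ) =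
        wave (intVec w) y * (f (y + intVec z) : ℂ) := fun z y => by rw [wave_add_intVec]
    simp_rw [hterm]
    rw [integral_tsum_of_summable_integral_norm]
    · refine setIntegral_congr_fun hmeas fun y _ => ?_
      simp only [mFourier_coe, hF, smul_eq_mul, gaussMass, ofReal_tsum, tsum_mul_left, f]
    · intro z
      have := (hwf.comp_add_right (intVec z)).integrableOn (s := cube 0)
      simp_rw [hterm] at this
      exact this
    · refine (hasSum_setIntegral_cube hf).summable.congr fun z => ?_
      congr with y
      rw [norm_mul, norm_wave, one_mul, norm_real, Real.norm_of_nonneg (Real.exp_pos _).le]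
  have hsum : Summable (UnitAddTorus.mFourierCoeff F) := by
    simp_rw [funext hcoeff]
    refine summable_ofReal.2 (Summable.mul_left _ ?_)
    have hA' : A⁻¹ᵀ.det ≠ 0 := by
      rw [Matrix.det_transpose, Matrix.det_nonsing_inv, Ring.inverse_eq_inv']
      exact inv_ne_zero hA
    simpa [div_eq_mul_inv] using summable_gaussTerm hA' (inv_pos.2 ht) 0
  have h := UnitAddTorus.hasSum_mFourier_series_apply_of_summable hsum
    (fun i => (x i : UnitAddCircle))
  rw [hF] at h
  have h' := hasSum_re h
  simp only [ofReal_re] at h'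
  convert h' using 2 with w
  rw [hcoeff, smul_eq_mul, re_ofReal_mul]
  congr 1
  have : UnitAddTorus.mFourier w (fun i => (x i : UnitAddCircle)) = wave (intVec (-w)) x := by
    rw [← mFourier_coe, neg_neg]
  rw [this, wave, Complex.exp_re]
  simp [intVec, dotProduct]

/-- The normalising factor `|det A|⁻¹ t ^ (-n/2)` in Poisson summation. -/
def gaussFactor [DecidableEq ι] (A : Matrix ι ι ℝ) (t : ℝ) : ℝ :=
  |A.det|⁻¹ * (1 / t) ^ (Fintype.card ι / 2 : ℝ)

theorem gaussFactor_pos [DecidableEq ι] {A : Matrix ι ι ℝ} (hA : A.det ≠ 0) {t : ℝ}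
    (ht : 0 < t) : 0 < gaussFactor A t := by
  unfold gaussFactor; positivity

theorem gaussFactor_half [DecidableEq ι] (A : Matrix ι ι ℝ) {t : ℝ} (ht : 0 < t) :
    gaussFactor A (t / 2) = √2 ^ Fintype.card ι * gaussFactor A t := by
  have h1 : 1 / (t / 2) = 2 * (1 / t) := by field_simp
  rw [gaussFactor, gaussFactor, h1, Real.mul_rpow (by norm_num) (by positivity),
    Real.sqrt_eq_rpow, ← Real.rpow_natCast, ← Real.rpow_mul (by norm_num)]
  ring_nf

theorem det_inv_transpose_ne_zero [DecidableEq ι] {A : Matrix ι ι ℝ} (hA : A.det ≠ 0) :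
    A⁻¹ᵀ.det ≠ 0 := by
  rw [Matrix.det_transpose, Matrix.det_nonsing_inv, Ring.inverse_eq_inv']
  exact inv_ne_zero hA

theorem hasSum_gaussMass_zero [DecidableEq ι] {A : Matrix ι ι ℝ} (hA : A.det ≠ 0) {t : ℝ}
    (ht : 0 < t) :
    HasSum (fun w : ι → ℤ => Real.exp (-(Real.pi * t * sqNorm (A *ᵥ intVec w))))
      (gaussMass A t 0) := by
  simpa [gaussMass] using (summable_gaussTerm hA ht 0).hasSum

theorem hasSum_dual [DecidableEq ι] {A : Matrix ι ι ℝ} (hA : A.det ≠ 0) {t : ℝ} (ht : 0 < t) :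
    HasSum (fun w : ι → ℤ => Real.exp (-(Real.pi / t * sqNorm (A⁻¹ᵀ *ᵥ intVec w))))
      (gaussMass A⁻¹ᵀ (1 / t) 0) := by
  simpa [div_eq_mul_inv] using
    hasSum_gaussMass_zero (det_inv_transpose_ne_zero hA) (one_div_pos.2 ht)

theorem gaussMass_le [DecidableEq ι] {A : Matrix ι ι ℝ} (hA : A.det ≠ 0) {t : ℝ} (ht : 0 < t)
    (x : ι → ℝ) : gaussMass A t x ≤ gaussFactor A t * gaussMass A⁻¹ᵀ (1 / t) 0 := by
  refine hasSum_le (fun w => ?_) (hasSum_gaussMass hA ht x)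
    ((hasSum_dual hA ht).mul_left (gaussFactor A t))
  exact mul_le_of_le_one_right (mul_nonneg (gaussFactor_pos hA ht).le (Real.exp_pos _).le)
    (Real.cos_le_one _)

theorem gaussMass_zero [DecidableEq ι] {A : Matrix ι ι ℝ} (hA : A.det ≠ 0) {t : ℝ} (ht : 0 < t) :
    gaussMass A t 0 = gaussFactor A t * gaussMass A⁻¹ᵀ (1 / t) 0 :=
  HasSum.unique (by simpa using hasSum_gaussMass hA ht 0)
    (by simpa [gaussFactor] using (hasSum_dual hA ht).mul_left (gaussFactor A t))

theorem le_gaussMass [DecidableEq ι] {A : Matrix ι ι ℝ} (hA : A.det ≠ 0) {t : ℝ} (ht : 0 < t)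
    (x : ι → ℝ) : gaussFactor A t * (2 - gaussMass A⁻¹ᵀ (1 / t) 0) ≤ gaussMass A t x := by
  have h := ((hasSum_ite_eq (0 : ι → ℤ) (2 : ℝ)).sub (hasSum_dual hA ht)).mul_left
    (gaussFactor A t)
  refine hasSum_le (fun w => ?_) h (hasSum_gaussMass hA ht x)
  rw [← gaussFactor, mul_assoc]
  refine mul_le_mul_of_nonneg_left ?_ (gaussFactor_pos hA ht).le
  split_ifs with hw
  · subst hw
    simp [intVec_zero, sqNorm]
    norm_num
  · have := Real.neg_one_le_cos (2 * Real.pi * (intVec w ⬝ᵥ x))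
    have := Real.exp_pos (-(Real.pi / t * sqNorm (A⁻¹ᵀ *ᵥ intVec w)))
    nlinarith

theorem gaussMass_anti [DecidableEq ι] {A : Matrix ι ι ℝ} (hA : A.det ≠ 0) {s t : ℝ}
    (hs : 0 < s) (hst : s ≤ t) : gaussMass A t 0 ≤ gaussMass A s 0 := by
  refine hasSum_le (fun w => ?_) (hasSum_gaussMass_zero hA (hs.trans_le hst))
    (hasSum_gaussMass_zero hA hs)
  have := sqNorm_nonneg (A *ᵥ intVec w)
  gcongr

theorem gaussMass_half_le [DecidableEq ι] {A : Matrix ι ι ℝ} (hA : A.det ≠ 0) {t : ℝ}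
    (ht : 0 < t) : gaussMass A (t / 2) 0 ≤ √2 ^ Fintype.card ι * gaussMass A t 0 := by
  rw [gaussMass_zero hA ht, gaussMass_zero hA (half_pos ht), gaussFactor_half A ht, mul_assoc]
  have := gaussFactor_pos hA ht
  gcongr
  refine gaussMass_anti (det_inv_transpose_ne_zero hA) (by positivity) ?_
  gcongr
  linarith

theorem sqrt_two_mul_exp_le : √2 * Real.exp (-(Real.pi / 2)) ≤ 2 / 5 := by
  have h1 : √2 ≤ 3 / 2 := Real.sqrt_le_iff.2 (by norm_num)
  have h2 : Real.exp (-(Real.pi / 2)) ≤ 4 / 15 := by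
    rw [Real.exp_neg, inv_le_comm₀ (Real.exp_pos _) (by norm_num)]
    have h3 : Real.exp 1 * Real.exp (1 / 2) ≤ Real.exp (Real.pi / 2) := by
      rw [← Real.exp_add, Real.exp_le_exp]; linarith [Real.pi_gt_three]
    have h4 := Real.add_one_le_exp (1 / 2 : ℝ)
    have h5 := Real.exp_one_gt_d9
    nlinarith
  calc √2 * Real.exp (-(Real.pi / 2)) ≤ 3 / 2 * (4 / 15) := by gcongr
    _ = 2 / 5 := by norm_num

/-- If the nonzero vectors of a lattice are long, its Gaussian mass is concentrated at `0`. -/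
theorem gaussMass_le_of_long [DecidableEq ι] [Nonempty ι] {B : Matrix ι ι ℝ} (hB : B.det ≠ 0)
    {t : ℝ} (ht : 0 < t)
    (h : ∀ w : ι → ℤ, w ≠ 0 → Fintype.card ι ≤ t * sqNorm (B *ᵥ intVec w)) :
    gaussMass B t 0 ≤ 5 / 3 := by
  set n := Fintype.card ι
  have h1 : gaussMass B t 0 ≤ 1 + Real.exp (-(Real.pi / 2)) ^ n * gaussMass B (t / 2) 0 := by
    refine hasSum_le (fun w => ?_) (hasSum_gaussMass_zero hB ht)
      ((hasSum_ite_eq (0 : ι → ℤ) (1 : ℝ)).add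
        ((hasSum_gaussMass_zero hB (half_pos ht)).mul_left (Real.exp (-(Real.pi / 2)) ^ n)))
    split_ifs with hw
    · subst hw
      simp only [intVec_zero, Matrix.mulVec_zero, sqNorm, Pi.zero_apply]
      simp only [ne_eq, OfNat.ofNat_ne_zero, not_false_eq_true, zero_pow, Finset.sum_const_zero,
        mul_zero, neg_zero, Real.exp_zero, mul_one, le_add_iff_nonneg_right]
      positivity
    · rw [zero_add, ← Real.exp_nat_mul, ← Real.exp_add, Real.exp_le_exp]
      have := mul_le_mul_of_nonneg_left (h w hw) (by positivity : 0 ≤ Real.pi / 2)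
      linarith
  have h2 := gaussMass_half_le hB ht
  have h3 : Real.exp (-(Real.pi / 2)) ^ n * gaussMass B (t / 2) 0 ≤ 2 / 5 * gaussMass B t 0 := by
    have h4 : (√2 * Real.exp (-(Real.pi / 2))) ^ n ≤ 2 / 5 :=
      (pow_le_of_le_one (by positivity) (sqrt_two_mul_exp_le.trans (by norm_num))
        Fintype.card_ne_zero).trans sqrt_two_mul_exp_le
    have h5 : 0 ≤ gaussMass B t 0 := tsum_nonneg fun _ => (Real.exp_pos _).le
    calc _ ≤ Real.exp (-(Real.pi / 2)) ^ n * (√2 ^ n * gaussMass B t 0) := by gcongr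
      _ = (√2 * Real.exp (-(Real.pi / 2))) ^ n * gaussMass B t 0 := by ring
      _ ≤ _ := by gcongr
  linarith

/-- **Transference**: if every nonzero dual vector has squared length at least `n t`, then
every point of space is within squared distance `2 n / t` of the lattice. -/
theorem exists_sqNorm_le_of_dual_long [DecidableEq ι] [Nonempty ι] {A : Matrix ι ι ℝ}
    (hA : A.det ≠ 0) {t : ℝ} (ht : 0 < t)
    (h : ∀ w : ι → ℤ, w ≠ 0 → Fintype.card ι * t ≤ sqNorm (A⁻¹ᵀ *ᵥ intVec w)) (x : ι → ℝ) :
    ∃ z : ι → ℤ, sqNorm (A *ᵥ (x + intVec z)) ≤ 2 * Fintype.card ι / t := by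
  by_contra! hfar
  set n := Fintype.card ι
  have hB := det_inv_transpose_ne_zero hA
  have hD : gaussMass A⁻¹ᵀ (1 / t) 0 ≤ 5 / 3 := by
    refine gaussMass_le_of_long hB (by positivity) fun w hw => ?_
    rw [one_div_mul_eq_div, le_div_iff₀ ht]
    exact h w hw
  have hD' : gaussMass A⁻¹ᵀ (1 / (t / 2)) 0 ≤ 5 / 3 := by
    refine (gaussMass_anti hB (by positivity) ?_).trans hD
    gcongr
    linarith
  have hK := gaussFactor_pos hA ht
  have h1 := le_gaussMass hA ht x
  have h2 := gaussMass_le hA (half_pos ht) x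
  rw [gaussFactor_half A ht] at h2
  have h3 : gaussMass A t x ≤ Real.exp (-Real.pi) ^ n * gaussMass A (t / 2) x := by
    refine hasSum_le (fun w => ?_) (summable_gaussTerm hA ht x).hasSum
      ((summable_gaussTerm hA (half_pos ht) x).hasSum.mul_left (Real.exp (-Real.pi) ^ n))
    rw [← Real.exp_nat_mul, ← Real.exp_add, Real.exp_le_exp]
    have h4 := (hfar w).le
    rw [div_le_iff₀ ht] at h4
    have := mul_le_mul_of_nonneg_left h4 (by positivity : 0 ≤ Real.pi / 2)
    linarith
  have h5 : (√2 * Real.exp (-Real.pi)) ^ n ≤ 4 / 25 := by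
    have h6 : √2 * Real.exp (-Real.pi) ≤ 4 / 25 := by
      have h7 := sqrt_two_mul_exp_le
      have h8 : (1 : ℝ) ≤ √2 := Real.one_le_sqrt.2 (by norm_num)
      have h9 : Real.exp (-Real.pi) = Real.exp (-(Real.pi / 2)) * Real.exp (-(Real.pi / 2)) := by
        rw [← Real.exp_add]; ring_nf
      have h10 : Real.exp (-(Real.pi / 2)) ≤ 2 / 5 :=
        (le_mul_of_one_le_left (Real.exp_pos _).le h8).trans h7
      calc √2 * Real.exp (-Real.pi)
          = (√2 * Real.exp (-(Real.pi / 2))) * Real.exp (-(Real.pi / 2)) := by rw [h9]; ring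
        _ ≤ 2 / 5 * (2 / 5) := by gcongr
        _ = 4 / 25 := by norm_num
    exact (pow_le_of_le_one (by positivity) (h6.trans (by norm_num)) Fintype.card_ne_zero).trans h6
  have h6 : gaussMass A t x ≤ 4 / 15 * gaussFactor A t := by
    calc gaussMass A t x
        ≤ Real.exp (-Real.pi) ^ n * (√2 ^ n * gaussFactor A t * (5 / 3)) := by
          refine h3.trans ?_
          gcongr
          exact h2.trans (by gcongr)
      _ = (√2 * Real.exp (-Real.pi)) ^ n * (gaussFactor A t * (5 / 3)) := by ring
      _ ≤ 4 / 25 * (gaussFactor A t * (5 / 3)) := by gcongr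
      _ = _ := by ring
  nlinarith

theorem one_le_sqNorm_intVec {w : ι → ℤ} (hw : w ≠ 0) : 1 ≤ sqNorm (intVec w) := by
  obtain ⟨i, hi⟩ := Function.ne_iff.1 hw
  have h1 : (1 : ℝ) ≤ (w i : ℝ) ^ 2 := by
    have hi : w i ≠ 0 := hi
    have : 0 < w i ^ 2 := by positivity
    exact_mod_cast this
  exact h1.trans (Finset.single_le_sum (f := fun i => (intVec w i) ^ 2)
    (fun _ _ => sq_nonneg _) (Finset.mem_univ i))

theorem sqNorm_le_card_mul_sq (v : ι → ℝ) : sqNorm v ≤ Fintype.card ι * ‖v‖ ^ 2 := by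
  have : ∀ i ∈ Finset.univ, v i ^ 2 ≤ ‖v‖ ^ 2 := fun i _ => by
    rw [← sq_abs]; gcongr; exact norm_le_pi_norm v i
  simpa [sqNorm] using Finset.sum_le_card_nsmul _ _ _ this

theorem exists_le_norm [DecidableEq ι] [Nonempty ι] {B : Matrix ι ι ℝ} (hB : B.det ≠ 0) :
    ∃ l > 0, ∀ w : ι → ℤ, w ≠ 0 → l ≤ ‖B *ᵥ intVec w‖ := by
  obtain ⟨κ, hκ, h⟩ := exists_mul_sqNorm_le hB
  have hn : (0 : ℝ) < Fintype.card ι := by exact_mod_cast Fintype.card_pos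
  refine ⟨√(κ / Fintype.card ι), by positivity, fun w hw => Real.sqrt_le_iff.2
    ⟨norm_nonneg _, ?_⟩⟩
  rw [div_le_iff₀' hn]
  exact (le_mul_of_one_le_right hκ.le (one_le_sqNorm_intVec hw)).trans
    ((h _).trans (sqNorm_le_card_mul_sq _))

theorem volume_cube (z : ι → ℤ) : volume (cube z) = 1 := by
  rw [cube_eq_pi, Real.volume_pi_Ioc]
  simp

theorem measurableSet_cube (z : ι → ℤ) : MeasurableSet (cube z) := by
  rw [cube_eq_pi]; exact MeasurableSet.univ_pi fun i => measurableSet_Ioc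

theorem exists_card_le [DecidableEq ι] {B : Matrix ι ι ℝ} (hB : |B.det| = 1) :
    ∃ M : ℝ, ∀ R, 0 ≤ R + M → ∀ s : Finset (ι → ℤ), (∀ w ∈ s, ‖B *ᵥ intVec w‖ ≤ R) →
      (s.card : ℝ) ≤ (2 * (R + M)) ^ Fintype.card ι := by
  let L := LinearMap.toContinuousLinearMap (Matrix.toLin' B)
  refine ⟨‖L‖, fun R hR s hs => ?_⟩
  have hsub : (⋃ w ∈ s, cube w) ⊆ Matrix.toLin' B ⁻¹' Metric.closedBall 0 (R + ‖L‖) := by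
    refine Set.iUnion₂_subset fun w hw y hy => ?_
    rw [Set.mem_preimage, mem_closedBall_zero_iff]
    have h1 : ‖y - intVec w‖ ≤ 1 := by
      refine (pi_norm_le_iff_of_nonneg zero_le_one).2 fun i => ?_
      have := hy i
      simp only [Set.mem_Ioc] at this
      simp only [Pi.sub_apply, intVec, Real.norm_eq_abs, abs_le]
      constructor <;> linarith
    have h2 : Matrix.toLin' B y = B *ᵥ intVec w + L (y - intVec w) := by
      simp [L, Matrix.mulVec_sub]
    rw [h2]
    exact (norm_add_le _ _).trans (add_le_add (hs w hw)
      ((L.le_opNorm _).trans (mul_le_of_le_one_right (norm_nonneg _) h1)))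
  have hdet : LinearMap.det (Matrix.toLin' B) = B.det := LinearMap.det_toLin' B
  have h := measure_mono (μ := volume) hsub
  rw [measure_biUnion_finset (fun a _ b _ hab => pairwise_disjoint_cube hab)
    (fun w _ => measurableSet_cube w), Measure.addHaar_preimage_linearMap, hdet, abs_inv, hB,
    Real.volume_pi_closedBall _ hR] at h
  · simp only [volume_cube, Finset.sum_const, nsmul_eq_mul, mul_one, inv_one, ENNReal.ofReal_one,
      one_mul] at h
    rw [← ENNReal.ofReal_natCast] at h
    exact (ENNReal.ofReal_le_ofReal_iff (by positivity)).1 h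
  · rw [hdet]
    intro h0
    simp [h0] at hB

/-- Sums of `‖v‖ ^ (-m)` over the nonzero vectors of norm at most `r 2 ^ k` of a unimodular
lattice of rank `m + 1` grow at most linearly in the radius. -/
theorem exists_sum_inv_norm_pow_le {m : ℕ} {B : Matrix (Fin (m + 1)) (Fin (m + 1)) ℝ}
    (hB : |B.det| = 1) {r : ℝ} (hr : 0 < r) : ∃ (A : ℝ) (k₀ : ℕ), ∀ k ≥ k₀,
      ∀ s : Finset (Fin (m + 1) → ℤ),
        (∀ w ∈ s, w ≠ 0 ∧ ‖B *ᵥ intVec w‖ ≤ r * 2 ^ k) →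
        ∑ w ∈ s, (‖B *ᵥ intVec w‖ ^ m)⁻¹ ≤ A + 8 ^ (m + 1) * (r * 2 ^ k) := by
  have hdet : B.det ≠ 0 := fun h => by simp [h] at hB
  obtain ⟨M, hM⟩ := exists_card_le hB
  obtain ⟨l, hl, hlow⟩ := exists_le_norm hdet
  obtain ⟨k₀, hk₀⟩ := pow_unbounded_of_one_lt (|M| / r) (one_lt_two (α := ℝ))
  rw [div_lt_iff₀' hr] at hk₀
  have hMk : ∀ k ≥ k₀, |M| ≤ r * 2 ^ k := fun k hk => hk₀.le.trans (by gcongr; norm_num)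
  refine ⟨(2 * (r * 2 ^ k₀ + M)) ^ (m + 1) * (l ^ m)⁻¹, k₀, fun k hk => ?_⟩
  induction k, hk using Nat.le_induction with
  | base =>
    intro s hs
    have h1 : ∀ w ∈ s, (‖B *ᵥ intVec w‖ ^ m)⁻¹ ≤ (l ^ m)⁻¹ := fun w hw => by
      gcongr; exact hlow w (hs w hw).1
    have h2 := hM (r * 2 ^ k₀) (by linarith [hMk k₀ le_rfl, neg_abs_le M]) s
      fun w hw => (hs w hw).2
    rw [Fintype.card_fin] at h2
    calc _ ≤ s.card * (l ^ m)⁻¹ := by simpa using Finset.sum_le_card_nsmul _ _ _ h1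
      _ ≤ (2 * (r * 2 ^ k₀ + M)) ^ (m + 1) * (l ^ m)⁻¹ := by gcongr
      _ ≤ _ := le_add_of_nonneg_right (by positivity)
  | succ k hk ih =>
    intro s hs
    rw [← Finset.sum_filter_add_sum_filter_not s (fun w => ‖B *ᵥ intVec w‖ ≤ r * 2 ^ k)]
    have h0 := ih (s.filter fun w => ‖B *ᵥ intVec w‖ ≤ r * 2 ^ k) fun w hw => by
      rw [Finset.mem_filter] at hw
      exact ⟨(hs w hw.1).1, hw.2⟩
    set s' := s.filter fun w => ¬ ‖B *ᵥ intVec w‖ ≤ r * 2 ^ k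
    have h1 : ∀ w ∈ s', (‖B *ᵥ intVec w‖ ^ m)⁻¹ ≤ ((r * 2 ^ k) ^ m)⁻¹ := fun w hw => by
      rw [Finset.mem_filter, not_le] at hw
      gcongr
      exact hw.2.le
    have hMk' := hMk (k + 1) (by omega)
    have h2 := hM (r * 2 ^ (k + 1)) (by linarith [neg_abs_le M]) s'
      fun w hw => (hs w (Finset.mem_filter.1 hw).1).2
    rw [Fintype.card_fin] at h2
    have h3 : 2 * (r * 2 ^ (k + 1) + M) ≤ 8 * (r * 2 ^ k) := by
      have := le_abs_self M
      rw [pow_succ] at *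
      linarith
    have h4 : ∑ w ∈ s', (‖B *ᵥ intVec w‖ ^ m)⁻¹ ≤ 8 ^ (m + 1) * (r * 2 ^ k) := by
      calc _ ≤ s'.card * ((r * 2 ^ k) ^ m)⁻¹ := by simpa using Finset.sum_le_card_nsmul _ _ _ h1
        _ ≤ (8 * (r * 2 ^ k)) ^ (m + 1) * ((r * 2 ^ k) ^ m)⁻¹ := by
          gcongr
          refine h2.trans ?_
          gcongr
          linarith [neg_abs_le M]
        _ = _ := by
          have : r * 2 ^ k ≠ 0 := by positivity
          generalize r * 2 ^ k = q at *
          rw [mul_pow, pow_succ q]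
          field_simp
    calc _ ≤ _ := add_le_add h0 h4
      _ = _ := by ring

/-- A Gaussian bound for the volume of a Euclidean ball. -/
theorem volume_sqNorm_le [Nonempty ι] {ρ : ℝ} (hρ : 0 < ρ) (u : ι → ℝ) :
    volume {y : ι → ℝ | sqNorm (y + u) ≤ ρ ^ 2} ≤
      ENNReal.ofReal ((Real.exp Real.pi * (ρ / √(Fintype.card ι))) ^ Fintype.card ι) := by
  classical
  set n := Fintype.card ι
  have hn : (0 : ℝ) < n := by exact_mod_cast Fintype.card_pos
  have hpre : {y : ι → ℝ | sqNorm (y + u) ≤ ρ ^ 2} =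
    (fun y => y + u) ⁻¹' {y | sqNorm y ≤ ρ ^ 2} := rfl
  rw [hpre, measure_preimage_add_right]
  set t : ℝ := n / ρ ^ 2
  have ht : 0 < t := by positivity
  let f : (ι → ℝ) → ℝ := fun y => Real.exp (-(Real.pi * t * sqNorm y))
  have hf : Integrable f := by
    simpa using integrable_gaussian (A := (1 : Matrix ι ι ℝ)) (by simp) ht
  have hint : ∫ y, f y = (ρ / √n) ^ n := by
    have h1 := integral_gaussian_mulVec (A := (1 : Matrix ι ι ℝ)) (by simp) ht 0
    simp only [zero_dotProduct, ofReal_zero, mul_zero, neg_zero, Complex.exp_zero, one_mul,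
      Matrix.one_mulVec, Matrix.mulVec_zero, Matrix.det_one, abs_one, inv_one] at h1
    have h2 := ofReal_injective (integral_complex_ofReal.symm.trans h1)
    have h3 : sqNorm (0 : ι → ℝ) = 0 := by simp [sqNorm]
    rw [h3, mul_zero, neg_zero, Real.exp_zero, mul_one] at h2
    have h4 : 1 / t = (ρ / √n) ^ 2 := by
      rw [div_pow, Real.sq_sqrt hn.le, one_div_div]
    rw [h4, ← Real.rpow_natCast (ρ / √n) 2, ← Real.rpow_mul (by positivity)] at h2
    rw [← Real.rpow_natCast (ρ / √n) n]
    convert h2 using 2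
    push_cast; ring
  have hM := mul_meas_ge_le_integral_of_nonneg (.of_forall fun y => (Real.exp_pos _).le) hf
    (Real.exp (-Real.pi) ^ n)
  rw [hint] at hM
  have hsub : {y : ι → ℝ | sqNorm y ≤ ρ ^ 2} ⊆ {y | Real.exp (-Real.pi) ^ n ≤ f y} := by
    intro y hy
    simp only [Set.mem_ofPred_eq] at hy ⊢
    rw [← Real.exp_nat_mul, Real.exp_le_exp]
    have h5 : t * sqNorm y ≤ n := by
      rw [div_mul_eq_mul_div, div_le_iff₀ (by positivity)]
      gcongr
    nlinarith [Real.pi_pos]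
  have hfin : volume {y | Real.exp (-Real.pi) ^ n ≤ f y} ≠ ⊤ :=
    (hf.measure_ge_lt_top (by positivity)).ne
  refine (measure_mono hsub).trans ?_
  rw [← ENNReal.ofReal_toReal hfin]
  refine ENNReal.ofReal_le_ofReal ?_
  rw [mul_pow, ← inv_mul_le_iff₀ (by positivity), ← inv_pow, ← Real.exp_neg]
  exact hM

/-- The unimodular upper triangular matrix with first row `(δ ^ m, δ⁻¹ x)` and remaining diagonal
entries `δ⁻¹`. -/
def shearMatrix {m : ℕ} (δ : ℝ) (x : Fin m → ℝ) : Matrix (Fin (m + 1)) (Fin (m + 1)) ℝ :=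
  Matrix.of (Fin.cons (Fin.cons (δ ^ m) (δ⁻¹ • x)) fun i => Fin.cons 0 (Pi.single i δ⁻¹))

theorem det_shearMatrix {m : ℕ} {δ : ℝ} (hδ : δ ≠ 0) (x : Fin m → ℝ) :
    (shearMatrix δ x).det = 1 := by
  rw [Matrix.det_of_isUpperTriangular, Fin.prod_univ_succ]
  · simp [shearMatrix, hδ]
  · intro i j hij
    simp only [id_eq] at hij
    induction i using Fin.cases with
    | zero => simp at hij
    | succ i =>
      induction j using Fin.cases with
      | zero => simp [shearMatrix]
      | succ j =>
        have : j ≠ i := fun h => by simp [h] at hij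
        simp [shearMatrix, this]

theorem sqNorm_shearMatrix {m : ℕ} (δ : ℝ) (x : Fin m → ℝ) (v : Fin (m + 1) → ℝ) :
    sqNorm ((shearMatrix δ x)ᵀ *ᵥ v) =
      (δ ^ m * v 0) ^ 2 + ∑ i, (δ⁻¹ * (x i * v 0 + v i.succ)) ^ 2 := by
  have h0 : ((shearMatrix δ x)ᵀ *ᵥ v) 0 = δ ^ m * v 0 := by
    simp [Matrix.mulVec, dotProduct, Fin.sum_univ_succ, shearMatrix]
  have h1 : ∀ i : Fin m, ((shearMatrix δ x)ᵀ *ᵥ v) i.succ = δ⁻¹ * (x i * v 0 + v i.succ) := by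
    intro i
    simp only [Matrix.mulVec, dotProduct, Fin.sum_univ_succ, shearMatrix, Matrix.transpose_apply,
      Matrix.of_apply, Fin.cons_zero, Fin.cons_succ, Pi.smul_apply, smul_eq_mul]
    rw [Finset.sum_eq_single i (fun k _ hk => by simp [hk.symm]) (by simp)]
    simp; ring
  rw [sqNorm, Fin.sum_univ_succ, h0]
  simp only [h1]

theorem norm_le_of_shear {m : ℕ} {δ r : ℝ} (hδ : 0 < δ) (hr : 0 ≤ r) {x : Fin m → ℝ}
    (hx : x ∈ cube (0 : Fin m → ℤ)) {v : Fin (m + 1) → ℝ} (hv : 2 * (r * δ) ≤ ‖v‖)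
    (h : sqNorm ((shearMatrix δ x)ᵀ *ᵥ v) ≤ r ^ 2) :
    ‖v‖ ≤ 2 * |v 0| ∧ δ ^ m * |v 0| ≤ r := by
  rw [sqNorm_shearMatrix] at h
  have hs : ∀ i, (δ⁻¹ * (x i * v 0 + v i.succ)) ^ 2 ≤ r ^ 2 := fun i =>
    (Finset.single_le_sum (f := fun i => (δ⁻¹ * (x i * v 0 + v i.succ)) ^ 2)
      (fun _ _ => sq_nonneg _) (Finset.mem_univ i)).trans
      ((le_add_of_nonneg_left (sq_nonneg _)).trans h)
  have h0 : (δ ^ m * v 0) ^ 2 ≤ r ^ 2 :=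
    (le_add_of_nonneg_right (Finset.sum_nonneg fun _ _ => sq_nonneg _)).trans h
  have h0' := abs_le_of_sq_le_sq h0 hr
  constructor
  · have hle : ‖v‖ ≤ |v 0| + r * δ := by
      refine (pi_norm_le_iff_of_nonneg (by positivity)).2 fun i => ?_
      rw [Real.norm_eq_abs]
      induction i using Fin.cases with
      | zero => exact le_add_of_nonneg_right (by positivity)
      | succ i =>
        have h2 := abs_le_of_sq_le_sq (hs i) hr
        have h3 : |x i * v 0 + v i.succ| ≤ r * δ := by
          rwa [abs_mul, abs_of_pos (inv_pos.2 hδ), inv_mul_le_iff₀ hδ, mul_comm δ] at h2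
        have hxi := hx i
        simp only [Pi.zero_apply, Int.cast_zero, zero_add, Set.mem_Ioc] at hxi
        have h4 : |x i * v 0| ≤ |v 0| := by
          rw [abs_mul, abs_of_pos hxi.1]
          exact mul_le_of_le_one_left (abs_nonneg _) hxi.2
        have h5 := abs_sub (x i * v 0 + v i.succ) (x i * v 0)
        rw [add_sub_cancel_left] at h5
        linarith
    linarith
  · rwa [abs_mul, abs_of_pos (by positivity)] at h0'

theorem volume_shear_le {m : ℕ} (hm : 1 ≤ m) {δ c : ℝ} (hδ : 0 < δ) (hc : 0 < c)
    {v : Fin (m + 1) → ℝ} (hv : 2 * (c * √(m + 1) * δ) ≤ ‖v‖) :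
    volume (cube (0 : Fin m → ℤ) ∩
        {x | sqNorm ((shearMatrix δ x)ᵀ *ᵥ v) ≤ (c * √(m + 1)) ^ 2}) ≤
      ENNReal.ofReal ((3 * Real.exp Real.pi * c * δ) ^ m * (‖v‖ ^ m)⁻¹) := by
  have : NeZero m := ⟨by omega⟩
  set r := c * √(m + 1)
  have hr : 0 < r := by positivity
  have hv0 : 0 < ‖v‖ := lt_of_lt_of_le (by positivity) hv
  rcases Set.eq_empty_or_nonempty (cube (0 : Fin m → ℤ) ∩
    {x | sqNorm ((shearMatrix δ x)ᵀ *ᵥ v) ≤ r ^ 2}) with he | ⟨x₀, hx₀, hx₀'⟩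
  · rw [he, measure_empty]; exact zero_le
  have h1 := (norm_le_of_shear hδ hr.le hx₀ hv hx₀').1
  have ha : 0 < |v 0| := by linarith
  have hv0' : v 0 ≠ 0 := abs_pos.1 ha
  have hball := volume_sqNorm_le (ρ := r * δ / |v 0|) (by positivity)
    (fun i : Fin m => v i.succ / v 0)
  refine (measure_mono ?_).trans (hball.trans (ENNReal.ofReal_le_ofReal ?_))
  · rintro x ⟨-, hx⟩
    simp only [Set.mem_ofPred_eq, sqNorm_shearMatrix] at hx ⊢
    have h2 := (le_add_of_nonneg_left (sq_nonneg _)).trans hx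
    have h3 : ∑ i, (δ⁻¹ * (x i * v 0 + v i.succ)) ^ 2 =
        (δ⁻¹ * v 0) ^ 2 * sqNorm (x + fun i => v i.succ / v 0) := by
      rw [sqNorm, Finset.mul_sum]
      refine Finset.sum_congr rfl fun i _ => ?_
      rw [← mul_pow, Pi.add_apply]
      congr 1
      field_simp
    rw [h3] at h2
    rw [div_pow, sq_abs, le_div_iff₀ (by positivity)]
    calc _ = δ ^ 2 * ((δ⁻¹ * v 0) ^ 2 * sqNorm (x + fun i => v i.succ / v 0)) := by
          field_simp
      _ ≤ δ ^ 2 * r ^ 2 := by gcongr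
      _ = _ := by ring
  · rw [Fintype.card_fin, ← inv_pow, ← mul_pow]
    refine pow_le_pow_left₀ (by positivity) ?_ m
    have hm' : (1 : ℝ) ≤ m := by exact_mod_cast hm
    have h4 : √((m : ℝ) + 1) ≤ 3 / 2 * √m := by
      rw [Real.sqrt_le_left (by positivity), mul_pow, Real.sq_sqrt (by positivity)]
      linarith
    have h5 : r * δ / |v 0| / √m ≤ 3 * c * δ * ‖v‖⁻¹ := by
      rw [div_div, div_le_iff₀ (by positivity)]
      calc r * δ ≤ c * (3 / 2 * √m) * δ := by gcongr; exact mul_le_mul_of_nonneg_left h4 hc.le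
        _ = 3 / 2 * c * δ * √m * (‖v‖⁻¹ * ‖v‖) := by rw [inv_mul_cancel₀ hv0.ne']; ring
        _ ≤ 3 / 2 * c * δ * √m * (‖v‖⁻¹ * (2 * |v 0|)) := by gcongr
        _ = _ := by ring
    calc _ ≤ Real.exp Real.pi * (3 * c * δ * ‖v‖⁻¹) := by gcongr
      _ = _ := by ring

/-- Dual vectors of a random lattice of rank `n` typically have length at least
`dualConst * √n`. -/
def dualConst : ℝ := (192 * Real.exp Real.pi)⁻¹

theorem dualConst_pos : 0 < dualConst := by unfold dualConst; positivity

theorem dualConst_le : dualConst ≤ 1 / 192 := by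
  unfold dualConst
  rw [mul_inv, one_div]
  exact mul_le_of_le_one_right (by norm_num)
    (inv_le_one_of_one_le₀ (Real.one_le_exp Real.pi_pos.le))

/-- For a fixed unimodular lattice, most points of a far expanded piece of a horosphere have no
short nonzero vector. -/
theorem eventually_volume_shear_le {m : ℕ} (hm : 1 ≤ m)
    {B : Matrix (Fin (m + 1)) (Fin (m + 1)) ℝ} (hB : |B.det| = 1) :
    ∀ᶠ j : ℕ in Filter.atTop, volume (cube (0 : Fin m → ℤ) ∩ {x | ∃ w ≠ 0,
        sqNorm ((shearMatrix (2⁻¹ ^ j) x)ᵀ *ᵥ (B *ᵥ intVec w)) ≤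
          (dualConst * √(m + 1)) ^ 2}) ≤
      ENNReal.ofReal (2⁻¹ ^ (m + 1)) := by
  have hc := dualConst_pos
  set c := dualConst with hcdef
  set r := c * √(m + 1)
  have hr : 0 < r := by positivity
  have hdet : B.det ≠ 0 := fun h => by simp [h] at hB
  obtain ⟨l, hl, hlow⟩ := exists_le_norm hdet
  obtain ⟨A, k₀, hA⟩ := exists_sum_inv_norm_pow_le hB (r := 2 * r) (by positivity)
  have hlim : Filter.Tendsto (fun j : ℕ => (2⁻¹ : ℝ) ^ j) Filter.atTop (nhds 0) :=
    tendsto_pow_atTop_nhds_zero_of_lt_one (by norm_num) (by norm_num)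
  have hlim1 : Filter.Tendsto (fun j : ℕ => 2 * (r * (2⁻¹ : ℝ) ^ j)) Filter.atTop (nhds 0) := by
    simpa using (hlim.const_mul r).const_mul 2
  have hlim2 : Filter.Tendsto (fun j : ℕ => (64⁻¹ : ℝ) ^ m * A * ((2⁻¹ : ℝ) ^ j) ^ m)
      Filter.atTop (nhds 0) := by
    simpa [show m ≠ 0 by omega] using (hlim.pow m).const_mul ((64⁻¹ : ℝ) ^ m * A)
  filter_upwards [hlim1.eventually_le_const hl,
    hlim2.eventually_le_const (show (0 : ℝ) < 2⁻¹ ^ m / 4 by positivity),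
    Filter.eventually_ge_atTop k₀] with j hj1 hj2 hj3
  set δ : ℝ := 2⁻¹ ^ j with hδdef
  have hδ : 0 < δ := by positivity
  have hδm : δ ^ m * 2 ^ (j * m) = 1 := by
    rw [hδdef, ← pow_mul, ← mul_pow]; norm_num
  have hk : k₀ ≤ j * m := hj3.trans (Nat.le_mul_of_pos_right _ hm)
  let S : (Fin (m + 1) → ℤ) → Set (Fin m → ℝ) := fun w => cube 0 ∩
    {x | w ≠ 0 ∧ sqNorm ((shearMatrix δ x)ᵀ *ᵥ (B *ᵥ intVec w)) ≤ r ^ 2}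
  have hS : cube (0 : Fin m → ℤ) ∩ {x | ∃ w ≠ 0,
      sqNorm ((shearMatrix δ x)ᵀ *ᵥ (B *ᵥ intVec w)) ≤ r ^ 2} = ⋃ w, S w := by
    ext x
    simp [S]
  have hSempty : ∀ w, ¬ (w ≠ 0 ∧ ‖B *ᵥ intVec w‖ ≤ 2 * r * 2 ^ (j * m)) → S w = ∅ := by
    intro w hw
    by_contra hne
    obtain ⟨x, hx, hw0, hxw⟩ := Set.nonempty_iff_ne_empty.2 hne
    obtain ⟨h1, h2⟩ := norm_le_of_shear hδ hr.le hx (hj1.trans (hlow w hw0)) hxw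
    refine hw ⟨hw0, h1.trans ?_⟩
    calc 2 * |(B *ᵥ intVec w) 0| = 2 * ((δ ^ m * 2 ^ (j * m)) * |(B *ᵥ intVec w) 0|) := by
          rw [hδm, one_mul]
      _ = 2 * (δ ^ m * |(B *ᵥ intVec w) 0|) * 2 ^ (j * m) := by ring
      _ ≤ _ := by gcongr
  have hSle : ∀ w ≠ 0, volume (S w) ≤ ENNReal.ofReal
      ((3 * Real.exp Real.pi * c * δ) ^ m * (‖B *ᵥ intVec w‖ ^ m)⁻¹) := fun w hw =>
    (measure_mono (Set.inter_subset_inter_right _ fun x hx => hx.2)).trans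
      (volume_shear_le hm hδ hc (hj1.trans (hlow w hw)))
  have hKc : 3 * Real.exp Real.pi * c = 64⁻¹ := by
    rw [hcdef, dualConst]
    field_simp
    norm_num
  have htotal : (3 * Real.exp Real.pi * c * δ) ^ m * (A + 8 ^ (m + 1) * (2 * r * 2 ^ (j * m)))
      ≤ 2⁻¹ ^ (m + 1) := by
    have h1 : √((m : ℝ) + 1) ≤ 4 ^ m := by
      refine (Real.sqrt_le_self_iff.2 (Or.inr (by simp))).trans ?_
      have : m + 1 ≤ 4 ^ m := Nat.lt_pow_self (by norm_num)
      exact_mod_cast this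
    have h2 : 16 * r * 8⁻¹ ^ m ≤ (2⁻¹ : ℝ) ^ m / 4 := by
      calc 16 * r * (8⁻¹ : ℝ) ^ m ≤ 16 * (1 / 192 * 4 ^ m) * 8⁻¹ ^ m := by
            gcongr
            exact mul_le_mul dualConst_le h1 (Real.sqrt_nonneg _) (by norm_num)
        _ = 1 / 12 * (4 * 8⁻¹) ^ m := by rw [mul_pow]; ring
        _ = 1 / 12 * 2⁻¹ ^ m := by norm_num
        _ ≤ _ := by
            have : (0 : ℝ) < 2⁻¹ ^ m := by positivity
            linarith
    calc _ = 64⁻¹ ^ m * A * δ ^ m + 16 * r * (8 * 64⁻¹) ^ m * (δ ^ m * 2 ^ (j * m)) := by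
          rw [hKc, mul_pow, mul_pow, pow_succ]; ring
      _ = 64⁻¹ ^ m * A * δ ^ m + 16 * r * 8⁻¹ ^ m := by rw [hδm]; norm_num
      _ ≤ 2⁻¹ ^ m / 4 + 2⁻¹ ^ m / 4 := add_le_add hj2 h2
      _ = _ := by ring
  rw [hS]
  refine (measure_iUnion_le _).trans ?_
  rw [ENNReal.tsum_eq_iSup_sum]
  refine iSup_le fun s => ?_
  classical
  rw [← Finset.sum_filter_of_ne (p := fun w => w ≠ 0 ∧ ‖B *ᵥ intVec w‖ ≤ 2 * r * 2 ^ (j * m))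
    fun w _ hw => by
      by_contra h
      exact hw (by rw [hSempty w h, measure_empty])]
  calc _ ≤ ∑ w ∈ s with w ≠ 0 ∧ ‖B *ᵥ intVec w‖ ≤ 2 * r * 2 ^ (j * m), ENNReal.ofReal
        ((3 * Real.exp Real.pi * c * δ) ^ m * (‖B *ᵥ intVec w‖ ^ m)⁻¹) :=
        Finset.sum_le_sum fun w hw => hSle w (Finset.mem_filter.1 hw).2.1
    _ ≤ _ := by
      rw [← ENNReal.ofReal_sum_of_nonneg fun _ _ => by positivity, ← Finset.mul_sum]
      refine ENNReal.ofReal_le_ofReal (le_trans ?_ htotal)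
      gcongr
      exact hA _ hk _ fun w hw => (Finset.mem_filter.1 hw).2

/-- The shear matrix as an element of the special linear group. -/
def shearSL {m : ℕ} {δ : ℝ} (hδ : δ ≠ 0) (x : Fin m → ℝ) : SL (m + 1) :=
  ⟨shearMatrix δ x, det_shearMatrix hδ x⟩

instance (n : ℕ) : IsTopologicalGroup (SL n) where
  continuous_inv := continuous_induced_rng.mpr continuous_induced_dom.matrix_adjugate
  continuous_mul := continuous_induced_rng.mpr <|
    (continuous_induced_dom.comp continuous_fst).mul (continuous_induced_dom.comp continuous_snd)

instance (n : ℕ) : BorelSpace (SL n ⧸ SLZ n) := ⟨rfl⟩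

theorem continuous_shearSL {m : ℕ} {δ : ℝ} (hδ : δ ≠ 0) :
    Continuous (shearSL hδ : (Fin m → ℝ) → SL (m + 1)) := by
  refine continuous_induced_rng.mpr (continuous_matrix fun i j => ?_)
  induction i using Fin.cases <;> induction j using Fin.cases <;>
    simp only [shearSL, shearMatrix, Function.comp_apply, Matrix.of_apply, Fin.cons_zero,
      Fin.cons_succ, Pi.smul_apply] <;> fun_prop

/-- The dual of the lattice `g ℤⁿ` has a nonzero vector shorter than `dualConst * √n`. -/
def HasShortDual {n : ℕ} (g : SL n) : Prop :=
  ∃ w : Fin n → ℤ, w ≠ 0 ∧ sqNorm ((↑(g⁻¹) : Matrix (Fin n) (Fin n) ℝ)ᵀ *ᵥ intVec w) <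
    (dualConst * √n) ^ 2

theorem isOpen_hasShortDual (n : ℕ) : IsOpen {g : SL n | HasShortDual g} := by
  have : {g : SL n | HasShortDual g} = ⋃ w : Fin n → ℤ, {g : SL n | w ≠ 0 ∧
      sqNorm ((↑(g⁻¹) : Matrix (Fin n) (Fin n) ℝ)ᵀ *ᵥ intVec w) < (dualConst * √n) ^ 2} := by
    ext g
    simp [HasShortDual]
  rw [this]
  refine isOpen_iUnion fun w => isOpen_const.and (isOpen_lt ?_ continuous_const)
  have hinv : Continuous fun g : SL n => (↑(g⁻¹) : Matrix (Fin n) (Fin n) ℝ) :=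
    continuous_induced_dom.comp continuous_inv
  exact continuous_sqNorm.comp (hinv.matrix_transpose.matrix_mulVec continuous_const)

theorem HasShortDual.of_mul_mem_SLZ {n : ℕ} {g γ : SL n} (hγ : γ ∈ SLZ n)
    (h : HasShortDual (g * γ)) : HasShortDual g := by
  obtain ⟨γ, rfl⟩ := hγ
  obtain ⟨w, hw, h⟩ := h
  refine ⟨(↑(γ⁻¹) : Matrix (Fin n) (Fin n) ℤ)ᵀ *ᵥ w, fun h0 => hw ?_, ?_⟩
  · have h1 := congrArg (fun u => (γ : Matrix (Fin n) (Fin n) ℤ)ᵀ *ᵥ u) h0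
    simp only [Matrix.mulVec_mulVec, ← Matrix.transpose_mul, Matrix.mulVec_zero] at h1
    rwa [← Matrix.SpecialLinearGroup.coe_mul, inv_mul_cancel, Matrix.SpecialLinearGroup.coe_one,
      Matrix.transpose_one, Matrix.one_mulVec] at h1
  · have h2 : intVec ((↑(γ⁻¹) : Matrix (Fin n) (Fin n) ℤ)ᵀ *ᵥ w) =
        (↑((Matrix.SpecialLinearGroup.map (Int.castRingHom ℝ) γ)⁻¹) :
          Matrix (Fin n) (Fin n) ℝ)ᵀ *ᵥ intVec w := by
      rw [← map_inv]
      ext i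
      simp [intVec, Matrix.mulVec, dotProduct, -map_inv, -Matrix.SpecialLinearGroup.coe_inv]
    rwa [h2, Matrix.mulVec_mulVec, ← Matrix.transpose_mul, ← Matrix.SpecialLinearGroup.coe_mul,
      ← _root_.mul_inv_rev]

/-- The set of lattices whose dual has a short nonzero vector. -/
def shortDualSet (n : ℕ) : Set (SL n ⧸ SLZ n) :=
  (fun g : SL n => (g : SL n ⧸ SLZ n)) '' {g | HasShortDual g}

theorem mk_mem_shortDualSet {n : ℕ} {g : SL n} :
    (g : SL n ⧸ SLZ n) ∈ shortDualSet n ↔ HasShortDual g := by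
  refine ⟨?_, fun h => ⟨g, h, rfl⟩⟩
  rintro ⟨g', h, hg⟩
  have hγ := QuotientGroup.eq.1 hg.symm
  exact HasShortDual.of_mul_mem_SLZ hγ (by rwa [mul_inv_cancel_left])

theorem isOpen_shortDualSet (n : ℕ) : IsOpen (shortDualSet n) :=
  QuotientGroup.isOpenMap_coe _ (isOpen_hasShortDual n)

theorem eventually_volume_smul_mem_shortDualSet_le {m : ℕ} (hm : 1 ≤ m)
    (q : SL (m + 1) ⧸ SLZ (m + 1)) :
    ∀ᶠ j : ℕ in Filter.atTop, (volume.restrict (cube (0 : Fin m → ℤ)))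
        {x | (shearSL (δ := 2⁻¹ ^ j) (by positivity) x)⁻¹ • q ∈ shortDualSet (m + 1)} ≤
      ENNReal.ofReal (2⁻¹ ^ (m + 1)) := by
  obtain ⟨g, rfl⟩ := QuotientGroup.mk_surjective q
  have hB : |((↑(g⁻¹) : Matrix (Fin (m + 1)) (Fin (m + 1)) ℝ)ᵀ).det| = 1 := by
    rw [Matrix.det_transpose, Matrix.SpecialLinearGroup.det_coe, abs_one]
  filter_upwards [eventually_volume_shear_le hm hB] with j hj
  rw [Measure.restrict_apply' (measurableSet_cube _), Set.inter_comm]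
  refine (measure_mono (Set.inter_subset_inter_right _ fun x hx => ?_)).trans hj
  obtain ⟨w, hw, h⟩ : HasShortDual ((shearSL _ x)⁻¹ * g) := mk_mem_shortDualSet.1 hx
  refine ⟨w, hw, ?_⟩
  rw [_root_.mul_inv_rev, inv_inv, Matrix.SpecialLinearGroup.coe_mul, Matrix.transpose_mul,
    ← Matrix.mulVec_mulVec] at h
  push_cast at h
  exact h.le

theorem measure_shortDualSet_le {m : ℕ} (hm : 1 ≤ m) (ν : Measure (SL (m + 1) ⧸ SLZ (m + 1)))
    [IsProbabilityMeasure ν] (hν : ∀ g : SL (m + 1), Measure.map (fun x => g • x) ν = ν) :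
    ν (shortDualSet (m + 1)) ≤ ENNReal.ofReal (2⁻¹ ^ (m + 1)) := by
  set μ : Measure (Fin m → ℝ) := volume.restrict (cube 0)
  have : IsProbabilityMeasure μ := ⟨by rw [Measure.restrict_apply_univ, volume_cube]⟩
  set E := shortDualSet (m + 1)
  have hE : IsOpen E := isOpen_shortDualSet _
  let S : ℕ → Set ((SL (m + 1) ⧸ SLZ (m + 1)) × (Fin m → ℝ)) := fun j =>
    {p | (shearSL (δ := 2⁻¹ ^ j) (by positivity) p.2)⁻¹ • p.1 ∈ E}
  have hS : ∀ j, MeasurableSet (S j) := fun j =>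
    (hE.preimage (((continuous_shearSL _).comp continuous_snd).inv.smul
      continuous_fst)).measurableSet
  have hint : ∀ j, ∫⁻ q, μ (Prod.mk q ⁻¹' S j) ∂ν = ν E := fun j => by
    rw [← Measure.prod_apply (hS j), Measure.prod_apply_symm (hS j)]
    have : ∀ x, ν ((fun q => (q, x)) ⁻¹' S j) = ν E := fun x => by
      conv_rhs => rw [← hν (shearSL (δ := 2⁻¹ ^ j) (by positivity) x)⁻¹]
      rw [Measure.map_apply (continuous_const_smul _).measurable hE.measurableSet]
      rfl
    simp [this]
  have hlim := limsup_lintegral_le (μ := ν) (f := fun j q => μ (Prod.mk q ⁻¹' S j)) (fun _ => 1)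
    (fun j => measurable_measure_prodMk_left (hS j))
    (fun j => .of_forall fun q => prob_le_one) (by simp)
  simp only [hint, Filter.limsup_const] at hlim
  refine hlim.trans ?_
  calc _ ≤ ∫⁻ _, ENNReal.ofReal (2⁻¹ ^ (m + 1)) ∂ν := lintegral_mono fun q =>
        Filter.limsup_le_of_le (by isBoundedDefault)
          (eventually_volume_smul_mem_shortDualSet_le hm q)
    _ = _ := by simp

theorem covRadOf_le_of_not_hasShortDual {n : ℕ} [NeZero n] {g : SL n} (hg : ¬ HasShortDual g) :
    covRadOf (latticeOf g) ≤ √2 / dualConst * √n := by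
  have hc := dualConst_pos
  have hdet : (g : Matrix (Fin n) (Fin n) ℝ).det = 1 := g.2
  have hinv : (g : Matrix (Fin n) (Fin n) ℝ)⁻¹ = ↑(g⁻¹) := by
    rw [Matrix.inv_def, hdet, Ring.inverse_one, one_smul, Matrix.SpecialLinearGroup.coe_inv]
  have hn : (0 : ℝ) < n := by exact_mod_cast NeZero.pos n
  have h := exists_sqNorm_le_of_dual_long (A := (g : Matrix (Fin n) (Fin n) ℝ))
    (by rw [hdet]; exact one_ne_zero) (t := dualConst ^ 2) (by positivity) fun w hw => by
      by_contra hlt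
      refine hg ⟨w, hw, ?_⟩
      rw [hinv, not_le, Fintype.card_fin] at hlt
      rw [mul_pow, Real.sq_sqrt hn.le]
      linarith
  rw [Fintype.card_fin] at h
  refine Real.iSup_le (fun x => ?_) (by positivity)
  obtain ⟨z, hz⟩ := h (-((↑(g⁻¹) : Matrix (Fin n) (Fin n) ℝ) *ᵥ x.ofLp))
  set p : EuclideanSpace ℝ (Fin n) := (EuclideanSpace.equiv (Fin n) ℝ).symm
    ((g : Matrix (Fin n) (Fin n) ℝ).mulVec fun j => (z j : ℝ)) with hp
  refine (infDist_le_dist_of_mem (show p ∈ latticeOf g from ⟨z, rfl⟩)).trans ?_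
  rw [EuclideanSpace.dist_eq]
  refine Real.sqrt_le_iff.2 ⟨by positivity, ?_⟩
  have h1 : (g : Matrix (Fin n) (Fin n) ℝ) *ᵥ
      (-((↑(g⁻¹) : Matrix (Fin n) (Fin n) ℝ) *ᵥ x.ofLp) + intVec z) = p.ofLp - x.ofLp := by
    rw [Matrix.mulVec_add, Matrix.mulVec_neg, Matrix.mulVec_mulVec,
      ← Matrix.SpecialLinearGroup.coe_mul, mul_inv_cancel, Matrix.SpecialLinearGroup.coe_one,
      Matrix.one_mulVec, neg_add_eq_sub]
    rfl
  rw [h1] at hz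
  calc ∑ i, dist (x.ofLp i) (p.ofLp i) ^ 2 = sqNorm (p.ofLp - x.ofLp) :=
        Finset.sum_congr rfl fun i _ => by
          rw [dist_comm, Real.dist_eq, sq_abs, Pi.sub_apply]
    _ ≤ _ := hz
    _ = _ := by
      rw [mul_pow, div_pow, Real.sq_sqrt hn.le, Real.sq_sqrt zero_le_two]
      ring

/-- There exist `d > 0`, `ε > 0` and `n₀` such that for every
`n ≥ n₀` and every `SL_n(ℝ)`-invariant Borel probability measure `ν` on
`SL_n(ℝ)/SL_n(ℤ)`, the measure of the set of lattices `g·ℤⁿ` whose covering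
radius is at least `d·√n` is at most `2^(−εn)`. -/
theorem random_lattice_covering_radius_small :
    ∃ d > (0 : ℝ), ∃ ε > (0 : ℝ), ∃ n₀ : ℕ, ∀ n : ℕ, n₀ ≤ n →
      ∀ ν : Measure (SL n ⧸ SLZ n), IsProbabilityMeasure ν →
        (∀ g : SL n, Measure.map (fun x => g • x) ν = ν) →
        ν {q : SL n ⧸ SLZ n | ∃ g : SL n, (g : SL n ⧸ SLZ n) = q ∧
            d * Real.sqrt n ≤ covRadOf (latticeOf g)}
          ≤ ENNReal.ofReal ((2 : ℝ) ^ (-(ε * n))) := by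
  have hc := dualConst_pos
  refine ⟨2 / dualConst, by positivity, 1, one_pos, 2, fun n hn ν _ hν => ?_⟩
  obtain ⟨m, rfl⟩ : ∃ m, n = m + 1 := ⟨n - 1, by omega⟩
  have hpow : (2 : ℝ) ^ (-(1 * ((m + 1 : ℕ) : ℝ))) = 2⁻¹ ^ (m + 1) := by
    rw [one_mul, Real.rpow_neg zero_le_two, Real.rpow_natCast, inv_pow]
  rw [hpow]
  refine (measure_mono ?_).trans (measure_shortDualSet_le (by omega) ν hν)
  rintro _ ⟨g, rfl, hg⟩
  rw [mk_mem_shortDualSet]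
  by_contra hns
  refine absurd (hg.trans (covRadOf_le_of_not_hasShortDual hns)) (not_le.2 ?_)
  have h2 : √2 < 2 := by
    rw [Real.sqrt_lt' two_pos]
    norm_num
  have : (0 : ℝ) < ((m + 1 : ℕ) : ℝ) := by positivity
  gcongr

end
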